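/- arXiv:2104.12065 — 2 statements merged into one kernel-verified Lean document; each statement's English description precedes it below -/
import Mathlib

section
/- Existence, uniqueness and monotonicity of the minimal extinction solution under Grey's condition. Assume a₁ > 0 and Condition (A). Then there exists a unique differentiable function v̄ : (0,∞) → (0,∞) such that (d/dt) v̄_t = −φ₀(v̄_t) for all t > 0 and v̄_t → ∞ as t ↓ 0; moreover, the map t ↦ v̄_t is decreasing. -/
open MeasureTheory Filter Set Topology
open scoped ENNReal Classical

noncomputable section

namespace AffinePaper

/-- Total variation distance between two measures:
`‖μ - ν‖_var = sup {|∫ f dμ - ∫ f dν| : f measurable, |f| ≤ 1}`. -/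
def tvDist {α : Type*} [MeasurableSpace α] (μ ν : Measure α) : ℝ :=
  ⨆ f : {f : α → ℝ // Measurable f ∧ ∀ x, |f x| ≤ 1},
    |(∫ x, f.1 x ∂μ) - ∫ x, f.1 x ∂ν|

/-- Translate of a measure on `ℝ` by `a`, i.e. `δ_a * σ`. -/
def translate (a : ℝ) (σ : Measure ℝ) : Measure ℝ := Measure.map (fun x => x + a) σ

/-- The function `φ` of the affine process. -/
def phi (a₁ b₁ α₁₁ α₁₂ α₂₁ α₂₂ : ℝ) (m : Measure (ℝ × ℝ)) (u : ℂ × ℂ) : ℂ :=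
  -(a₁ : ℂ) * u.1 - (b₁ : ℂ) * u.2 + ((α₁₁ : ℂ) + (α₁₂ : ℂ)) * u.1 ^ 2
    + 2 * ((Real.sqrt (α₁₁ * α₂₁) : ℂ) + (Real.sqrt (α₁₂ * α₂₂) : ℂ)) * u.1 * u.2
    + ((α₂₁ : ℂ) + (α₂₂ : ℂ)) * u.2 ^ 2
    + ∫ z : ℝ × ℝ,
        (Complex.exp (u.1 * (z.1 : ℂ) + u.2 * (z.2 : ℂ)) - 1
          - (u.1 * (z.1 : ℂ) + u.2 * (z.2 : ℂ))) ∂m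

/-- The function `ψ` of the affine process. -/
def psi (a₂ b₀ σ : ℝ) (n : Measure (ℝ × ℝ)) (u : ℂ × ℂ) : ℂ :=
  (a₂ : ℂ) * u.1 - (b₀ : ℂ) * u.2 + (σ : ℂ) ^ 2 / 2 * u.2 ^ 2
    + ∫ z : ℝ × ℝ,
        (Complex.exp (u.1 * (z.1 : ℂ) + u.2 * (z.2 : ℂ)) - 1 - (z.2 : ℂ) * u.2) ∂n

/-- The branching mechanism `φ₀`. -/
def phi0 (a₁ α₁₁ α₁₂ : ℝ) (m : Measure (ℝ × ℝ)) (x : ℝ) : ℝ :=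
  a₁ * x + (α₁₁ + α₁₂) * x ^ 2 + ∫ z : ℝ × ℝ, (Real.exp (-x * z.1) - 1 + x * z.1) ∂m

/-- Condition (A): Grey's condition. -/
def CondA (a₁ α₁₁ α₁₂ : ℝ) (m : Measure (ℝ × ℝ)) : Prop :=
  ∃ θ > (0 : ℝ), (∀ z ≥ θ, 0 < phi0 a₁ α₁₁ α₁₂ m z) ∧
    ∫⁻ z in Set.Ici θ, ENNReal.ofReal (phi0 a₁ α₁₁ α₁₂ m z)⁻¹ < ⊤

/-- The measure `n_ε` on `ℝ`. -/
def nEps (n : Measure (ℝ × ℝ)) (ε : ℝ) : Measure ℝ :=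
  if n {z : ℝ × ℝ | 0 ≤ z.1} < ⊤ then
    Measure.map Prod.snd (n.restrict {z : ℝ × ℝ | 0 ≤ z.1})
  else
    Measure.map Prod.snd (n.restrict {z : ℝ × ℝ | 0 ≤ z.1 ∧ ε ≤ |z.2|})

/-- Condition (B), with the constants `ε, η` explicit. -/
def CondB (n : Measure (ℝ × ℝ)) (ε η : ℝ) : Prop :=
  0 < ε ∧ 0 < η ∧
  (∃ c : ℝ≥0∞, 0 < c ∧
      ∀ a : ℝ, |a| ≤ η → c ≤ (nEps n ε ⊓ translate a (nEps n ε)) Set.univ) ∧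
  ∫⁻ z in {z : ℝ × ℝ | ε < |z.2|}, ENNReal.ofReal |z.2| ∂n < ⊤

/-- `limsup_{ρ → 0} [ sup_{|a| ≤ ρ} ‖σ - δ_a * σ‖_var / ρ ] < ∞`. -/
def SmoothShift (σ : Measure ℝ) : Prop :=
  ∃ C > (0 : ℝ), ∃ δ > (0 : ℝ), ∀ ρ : ℝ, 0 < ρ → ρ ≤ δ →
    ∀ a : ℝ, |a| ≤ ρ → tvDist σ (translate a σ) ≤ C * ρ

/-- Condition (C), with the constant `ε` explicit. -/
def CondC (n : Measure (ℝ × ℝ)) (ε : ℝ) : Prop :=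
  0 < ε ∧ 0 < nEps n ε Set.univ ∧ SmoothShift (nEps n ε) ∧
  ∫⁻ z in {z : ℝ × ℝ | ε < |z.2|}, ENNReal.ofReal |z.2| ∂n < ⊤

/-- Condition (C'), with the constant `ε` explicit. -/
def CondC' (n : Measure (ℝ × ℝ)) (ε : ℝ) : Prop :=
  0 < ε ∧ 0 < nEps n ε Set.univ ∧ SmoothShift (nEps n ε) ∧
  ∫⁻ z in {z : ℝ × ℝ | 1 < |z.2|}, ENNReal.ofReal (z.2 ^ 2) ∂n < ⊤

/-- The measure `σ₀ = ϱ₀(z₂) dz₂` of Condition (D). -/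
def sigma0 (ϱ₀ : ℝ → ℝ) : Measure ℝ :=
  volume.withDensity fun x => ENNReal.ofReal (ϱ₀ x)

/-- The measure `σ_k = ((k g) ∧ ϱ₀)(z₂) dz₂` of Condition (D). -/
def sigmaK (ϱ₀ g : ℝ → ℝ) (k : ℕ) : Measure ℝ :=
  volume.withDensity fun x => ENNReal.ofReal (min ((k : ℝ) * g x) (ϱ₀ x))

/-- Condition (D), with `ϱ₀`, `g` and `K` explicit. -/
def CondD (n : Measure (ℝ × ℝ)) (ϱ₀ g : ℝ → ℝ) (K : ℕ) : Prop :=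
  Measurable ϱ₀ ∧ (∀ x, 0 ≤ ϱ₀ x) ∧
  (∀ B : Set ℝ, MeasurableSet B → sigma0 ϱ₀ B ≤ n {z : ℝ × ℝ | 0 ≤ z.1 ∧ z.2 ∈ B}) ∧
  0 < sigma0 ϱ₀ Set.univ ∧
  (∀ x, 0 < g x) ∧ Integrable g ∧ 1 ≤ K ∧
  ∀ k, K ≤ k → SmoothShift (sigmaK ϱ₀ g k) ∧
    ∫⁻ x, ENNReal.ofReal |x| ∂(sigmaK ϱ₀ g k) < ⊤

/-- The transition semigroup of a (1+1)-dimensional affine Markov process, together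
with all the standing assumptions of the paper. -/
structure AffineSemigroup where
  a₁ : ℝ
  a₂ : ℝ
  b₀ : ℝ
  b₁ : ℝ
  b₂ : ℝ
  σ : ℝ
  α₁₁ : ℝ
  α₁₂ : ℝ
  α₂₁ : ℝ
  α₂₂ : ℝ
  m : Measure (ℝ × ℝ)
  n : Measure (ℝ × ℝ)
  V₁ : ℝ → ℂ × ℂ → ℂ
  P : ℝ → ℝ × ℝ → Measure (ℝ × ℝ)
  a₂_nonneg : 0 ≤ a₂
  σ_nonneg : 0 ≤ σ
  α₁₁_nonneg : 0 ≤ α₁₁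
  α₁₂_nonneg : 0 ≤ α₁₂
  α₂₁_nonneg : 0 ≤ α₂₁
  α₂₂_nonneg : 0 ≤ α₂₂
  m_supp : m {z : ℝ × ℝ | z.1 < 0 ∨ z = 0} = 0
  n_supp : n {z : ℝ × ℝ | z.1 < 0 ∨ z = 0} = 0
  m_int : ∫⁻ z : ℝ × ℝ, ENNReal.ofReal (min z.1 (z.1 ^ 2) + z.2 ^ 2) ∂m < ⊤
  n_int : ∫⁻ z : ℝ × ℝ, ENNReal.ofReal (min 1 z.1 + min |z.2| (z.2 ^ 2)) ∂n < ⊤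
  V₁_init : ∀ u : ℂ × ℂ, V₁ 0 u = u.1
  V₁_mem : ∀ u : ℂ × ℂ, u.1.re ≤ 0 → u.2.re = 0 → ∀ t, 0 ≤ t → (V₁ t u).re ≤ 0
  V₁_ode : ∀ u : ℂ × ℂ, u.1.re ≤ 0 → u.2.re = 0 → ∀ t, 0 ≤ t →
    HasDerivAt (fun s => V₁ s u)
      (phi a₁ b₁ α₁₁ α₁₂ α₂₁ α₂₂ m
        (V₁ t u, Complex.exp (-(b₂ : ℂ) * (t : ℂ)) * u.2)) t
  P_prob : ∀ t, 0 ≤ t → ∀ x : ℝ × ℝ, 0 ≤ x.1 → IsProbabilityMeasure (P t x)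
  P_supp : ∀ t, 0 ≤ t → ∀ x : ℝ × ℝ, 0 ≤ x.1 → P t x {ξ : ℝ × ℝ | ξ.1 < 0} = 0
  P_meas : ∀ t, 0 ≤ t → Measurable (P t)
  P_zero : ∀ x : ℝ × ℝ, P 0 x = Measure.dirac x
  P_CK : ∀ t, 0 ≤ t → ∀ s, 0 ≤ s → ∀ x : ℝ × ℝ, P (t + s) x = (P t x).bind (P s)
  P_char : ∀ t, 0 ≤ t → ∀ x : ℝ × ℝ, 0 ≤ x.1 → ∀ u : ℂ × ℂ, u.1.re = 0 → u.2.re = 0 →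
    ∫ ξ : ℝ × ℝ, Complex.exp (u.1 * (ξ.1 : ℂ) + u.2 * (ξ.2 : ℂ)) ∂(P t x)
      = Complex.exp ((x.1 : ℂ) * V₁ t u
          + (x.2 : ℂ) * (Complex.exp (-(b₂ : ℂ) * (t : ℂ)) * u.2)
          + ∫ s in (0:ℝ)..t,
              psi a₂ b₀ σ n (V₁ s u, Complex.exp (-(b₂ : ℂ) * (s : ℂ)) * u.2))

/-- A stationary (invariant) distribution for the semigroup `P` on `G = ℝ₊ × ℝ`. -/
def IsStationary (P : ℝ → ℝ × ℝ → Measure (ℝ × ℝ)) (π : Measure (ℝ × ℝ)) : Prop :=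
  IsProbabilityMeasure π ∧ π {x : ℝ × ℝ | x.1 < 0} = 0 ∧ ∀ t, 0 ≤ t → π.bind (P t) = π

/-- Defining properties of the minimal solution `v̄` of `(d/dt) v̄_t = -φ₀(v̄_t)`,
`v̄_{0+} = ∞`. -/
def IsVbar (a₁ α₁₁ α₁₂ : ℝ) (m : Measure (ℝ × ℝ)) (v : ℝ → ℝ) : Prop :=
  (∀ t > (0 : ℝ), 0 < v t) ∧
  (∀ t > (0 : ℝ), HasDerivAt v (-(phi0 a₁ α₁₁ α₁₂ m (v t))) t) ∧
  Tendsto v (𝓝[>] (0 : ℝ)) atTop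

theorem compensatedExp_nonneg (x z : ℝ) : 0 ≤ Real.exp (-x * z) - 1 + x * z := by
  have := Real.add_one_le_exp (-x * z)
  linarith

theorem compensatedExp_le {x z : ℝ} (hx : 0 ≤ x) (hz : 0 ≤ z) :
    Real.exp (-x * z) - 1 + x * z ≤ (x + x ^ 2) * min z (z ^ 2) := by
  have hu : 0 ≤ x * z := mul_nonneg hx hz
  rcases min_cases z (z ^ 2) with ⟨h, -⟩ | ⟨h, -⟩ <;> rw [h]
  · have h1 : Real.exp (-x * z) ≤ 1 := Real.exp_le_one_iff.2 (by linarith)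
    nlinarith [mul_nonneg (sq_nonneg x) hz]
  · have h1 : Real.exp (-x * z) * Real.exp (x * z) = 1 := by
      rw [← Real.exp_add]; simp
    have h2 := Real.add_one_le_exp (x * z)
    have h3 := Real.exp_pos (-x * z)
    have h4 : Real.exp (-x * z) ≤ 1 - x * z + (x * z) ^ 2 := by
      have h5 : Real.exp (-x * z) * (x * z + 1) ≤ 1 :=
        (mul_le_mul_of_nonneg_left h2 h3.le).trans_eq h1
      have h6 : 1 ≤ (1 - x * z + (x * z) ^ 2) * (x * z + 1) := by
        nlinarith [pow_nonneg hu 3]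
      exact le_of_mul_le_mul_right (h5.trans h6) (by linarith)
    nlinarith [mul_nonneg hx (sq_nonneg z)]

section BranchingMechanism

variable {m : Measure (ℝ × ℝ)}

theorem ae_fst_nonneg (hm_supp : m {z : ℝ × ℝ | z.1 < 0 ∨ z = 0} = 0) :
    ∀ᵐ z ∂m, 0 ≤ z.1 := by
  rw [ae_iff]
  refine measure_mono_null (fun z hz => ?_) hm_supp
  exact Or.inl (not_le.1 hz)

theorem integrable_min_fst
    (hm_supp : m {z : ℝ × ℝ | z.1 < 0 ∨ z = 0} = 0)
    (hm_int : ∫⁻ z : ℝ × ℝ, ENNReal.ofReal (min z.1 (z.1 ^ 2) + z.2 ^ 2) ∂m < ⊤) :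
    Integrable (fun z : ℝ × ℝ => min z.1 (z.1 ^ 2)) m := by
  refine ⟨by fun_prop, ?_⟩
  have h0 : ∀ᵐ z : ℝ × ℝ ∂m, 0 ≤ min z.1 (z.1 ^ 2) := by
    filter_upwards [ae_fst_nonneg hm_supp] with z hz
    exact le_min hz (sq_nonneg _)
  rw [hasFiniteIntegral_iff_ofReal h0]
  refine lt_of_le_of_lt (lintegral_mono fun z => ?_) hm_int
  exact ENNReal.ofReal_le_ofReal (by nlinarith [sq_nonneg z.2])

theorem continuousOn_phi0 (a₁ α₁₁ α₁₂ : ℝ)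
    (hm_supp : m {z : ℝ × ℝ | z.1 < 0 ∨ z = 0} = 0)
    (hm_int : ∫⁻ z : ℝ × ℝ, ENNReal.ofReal (min z.1 (z.1 ^ 2) + z.2 ^ 2) ∂m < ⊤) :
    ContinuousOn (phi0 a₁ α₁₁ α₁₂ m) (Ioi 0) := by
  have key : ∀ R : ℝ, ContinuousOn (phi0 a₁ α₁₁ α₁₂ m) (Ioo 0 R) := by
    intro R
    unfold phi0
    refine ContinuousOn.add (by fun_prop) ?_
    refine continuousOn_of_dominated (bound := fun z => (R + R ^ 2) * min z.1 (z.1 ^ 2)) ?_ ?_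
      ((integrable_min_fst hm_supp hm_int).const_mul _) ?_
    · intro x _
      fun_prop
    · intro x hx
      filter_upwards [ae_fst_nonneg hm_supp] with z hz
      rw [Real.norm_of_nonneg (compensatedExp_nonneg _ _)]
      refine (compensatedExp_le hx.1.le hz).trans ?_
      have h0 : 0 ≤ min z.1 (z.1 ^ 2) := le_min hz (sq_nonneg _)
      have := hx.1.le
      have := hx.2.le
      gcongr
    · refine Eventually.of_forall fun z => ?_
      fun_prop
  intro x hx
  exact ((key (x + 1)).continuousAt (Ioo_mem_nhds hx (lt_add_one x))).continuousWithinAt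

theorem phi0_pos {a₁ α₁₁ α₁₂ : ℝ} (ha₁ : 0 < a₁) (hα₁₁ : 0 ≤ α₁₁) (hα₁₂ : 0 ≤ α₁₂)
    {x : ℝ} (hx : 0 < x) : 0 < phi0 a₁ α₁₁ α₁₂ m x := by
  have h : 0 ≤ ∫ z : ℝ × ℝ, (Real.exp (-x * z.1) - 1 + x * z.1) ∂m :=
    integral_nonneg fun z => compensatedExp_nonneg _ _
  unfold phi0
  positivity

theorem phi0_le {a₁ α₁₁ α₁₂ : ℝ} (ha₁ : 0 < a₁) (hα₁₁ : 0 ≤ α₁₁) (hα₁₂ : 0 ≤ α₁₂)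
    (hm_supp : m {z : ℝ × ℝ | z.1 < 0 ∨ z = 0} = 0)
    (hm_int : ∫⁻ z : ℝ × ℝ, ENNReal.ofReal (min z.1 (z.1 ^ 2) + z.2 ^ 2) ∂m < ⊤)
    {x : ℝ} (hx : 0 ≤ x) :
    phi0 a₁ α₁₁ α₁₂ m x ≤
      (a₁ + (α₁₁ + α₁₂) + ∫ z : ℝ × ℝ, min z.1 (z.1 ^ 2) ∂m) * (x + x ^ 2) := by
  have h : ∫ z : ℝ × ℝ, (Real.exp (-x * z.1) - 1 + x * z.1) ∂m ≤
      ∫ z : ℝ × ℝ, (x + x ^ 2) * min z.1 (z.1 ^ 2) ∂m := by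
    refine integral_mono_of_nonneg (Eventually.of_forall fun z => compensatedExp_nonneg _ _)
      ((integrable_min_fst hm_supp hm_int).const_mul _) ?_
    filter_upwards [ae_fst_nonneg hm_supp] with z hz
    exact compensatedExp_le hx hz
  rw [integral_const_mul] at h
  unfold phi0
  nlinarith [mul_nonneg ha₁.le (sq_nonneg x), mul_nonneg (add_nonneg hα₁₁ hα₁₂) hx]

end BranchingMechanism

section AutonomousODE

variable {f : ℝ → ℝ} {θ : ℝ}

/-- The time a solution of `v' = -f v` needs to come down from infinity to `x`,
when `1 / f` is integrable at infinity. -/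
def hittingTime (f : ℝ → ℝ) (θ x : ℝ) : ℝ :=
  (∫ y in Ioi θ, (f y)⁻¹) - ∫ y in θ..x, (f y)⁻¹

theorem hasDerivAt_hittingTime (hθ : 0 < θ) (hf : ContinuousOn f (Ioi 0))
    (hpos : ∀ x > 0, 0 < f x) {x : ℝ} (hx : 0 < x) :
    HasDerivAt (hittingTime f θ) (-(f x)⁻¹) x := by
  have hc : ContinuousOn (fun y => (f y)⁻¹) (Ioi 0) := hf.inv₀ fun y hy => (hpos y hy).ne'
  refine HasDerivAt.const_sub _ (intervalIntegral.integral_hasDerivAt_right ?_ ?_ ?_)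
  · refine (hc.mono fun y hy => ?_).intervalIntegrable
    exact (lt_min hθ hx).trans_le hy.1
  · exact hc.stronglyMeasurableAtFilter isOpen_Ioi x hx
  · exact hc.continuousAt (Ioi_mem_nhds hx)

theorem continuousOn_hittingTime (hθ : 0 < θ) (hf : ContinuousOn f (Ioi 0))
    (hpos : ∀ x > 0, 0 < f x) : ContinuousOn (hittingTime f θ) (Ioi 0) := fun _ hx =>
  (hasDerivAt_hittingTime hθ hf hpos hx).continuousAt.continuousWithinAt

theorem strictAntiOn_hittingTime (hθ : 0 < θ) (hf : ContinuousOn f (Ioi 0))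
    (hpos : ∀ x > 0, 0 < f x) : StrictAntiOn (hittingTime f θ) (Ioi 0) := by
  refine strictAntiOn_of_deriv_neg (convex_Ioi 0) (continuousOn_hittingTime hθ hf hpos) ?_
  intro x hx
  rw [interior_Ioi] at hx
  rw [(hasDerivAt_hittingTime hθ hf hpos hx).deriv]
  exact neg_neg_of_pos (inv_pos.2 (hpos x hx))

theorem tendsto_hittingTime_atTop (hint : IntegrableOn (fun y => (f y)⁻¹) (Ioi θ)) :
    Tendsto (hittingTime f θ) atTop (𝓝 0) := by
  have := (intervalIntegral_tendsto_integral_Ioi θ hint tendsto_id).const_sub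
    (∫ y in Ioi θ, (f y)⁻¹)
  rw [sub_self] at this
  exact this

theorem hittingTime_pos (hθ : 0 < θ) (hf : ContinuousOn f (Ioi 0)) (hpos : ∀ x > 0, 0 < f x)
    (hint : IntegrableOn (fun y => (f y)⁻¹) (Ioi θ)) {x : ℝ} (hx : 0 < x) :
    0 < hittingTime f θ x := by
  have hanti := strictAntiOn_hittingTime hθ hf hpos
  have hx1 : (0 : ℝ) < x + 1 := by linarith
  refine lt_of_le_of_lt ?_ (hanti hx hx1 (lt_add_one x))
  refine le_of_tendsto (tendsto_hittingTime_atTop hint) ?_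
  filter_upwards [eventually_ge_atTop (x + 1)] with y hy
  exact hanti.antitoneOn hx1 (hx1.trans_le hy) hy

/-- If `f` is at most linear near `0`, then solutions never reach `0`. -/
theorem tendsto_hittingTime_zero (hθ : 0 < θ) (hf : ContinuousOn f (Ioi 0))
    (hpos : ∀ x > 0, 0 < f x) {C : ℝ} (hC : 0 < C) (hle : ∀ x ∈ Ioo 0 θ, f x ≤ C * x) :
    Tendsto (hittingTime f θ) (𝓝[>] 0) atTop := by
  have hd : ∀ x : ℝ, 0 < x → HasDerivAt (fun y => hittingTime f θ y + C⁻¹ * Real.log y)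
      (-(f x)⁻¹ + C⁻¹ * x⁻¹) x := fun x hx =>
    (hasDerivAt_hittingTime hθ hf hpos hx).add ((Real.hasDerivAt_log hx.ne').const_mul _)
  have hanti : AntitoneOn (fun y => hittingTime f θ y + C⁻¹ * Real.log y) (Ioc 0 θ) := by
    refine antitoneOn_of_deriv_nonpos (convex_Ioc 0 θ)
      (fun x hx => (hd x hx.1).continuousAt.continuousWithinAt) ?_ ?_
    · rw [interior_Ioc]
      exact fun x hx => (hd x hx.1).differentiableAt.differentiableWithinAt
    · rw [interior_Ioc]
      intro x hx
      rw [(hd x hx.1).deriv, ← mul_inv]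
      have := inv_anti₀ (hpos x hx.1) (hle x hx)
      linarith
  have hlog : Tendsto (fun x => (hittingTime f θ θ + C⁻¹ * Real.log θ) + C⁻¹ * -Real.log x)
      (𝓝[>] 0) atTop :=
    tendsto_atTop_add_const_left _ _
      ((tendsto_neg_atBot_atTop.comp Real.tendsto_log_nhdsGT_zero).const_mul_atTop (inv_pos.2 hC))
  refine tendsto_atTop_mono' _ ?_ hlog
  filter_upwards [Ioc_mem_nhdsGT hθ] with x hx
  have := hanti hx ⟨hθ, le_rfl⟩ hx.2
  simp only at this
  linarith

theorem exists_hittingTime_eq (hθ : 0 < θ) (hf : ContinuousOn f (Ioi 0))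
    (hpos : ∀ x > 0, 0 < f x) (hint : IntegrableOn (fun y => (f y)⁻¹) (Ioi θ))
    {C : ℝ} (hC : 0 < C) (hle : ∀ x ∈ Ioo 0 θ, f x ≤ C * x) {t : ℝ} (ht : 0 < t) :
    ∃ x > 0, hittingTime f θ x = t := by
  obtain ⟨a, hta, ha⟩ := (((tendsto_hittingTime_zero hθ hf hpos hC hle).eventually_ge_atTop t).and
    self_mem_nhdsWithin).exists
  obtain ⟨b, htb, hb⟩ := (((tendsto_hittingTime_atTop hint).eventually_le_const ht).and
    (eventually_gt_atTop 0)).exists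
  exact isPreconnected_Ioi.intermediate_value hb ha (continuousOn_hittingTime hθ hf hpos)
    ⟨htb, hta⟩

/-- A solution of `w' = -f w` started from infinity is inverse to the hitting time. -/
theorem hittingTime_solution (hθ : 0 < θ) (hf : ContinuousOn f (Ioi 0))
    (hpos : ∀ x > 0, 0 < f x) (hint : IntegrableOn (fun y => (f y)⁻¹) (Ioi θ))
    {w : ℝ → ℝ} (hw0 : ∀ t > 0, 0 < w t) (hw : ∀ t > 0, HasDerivAt w (-f (w t)) t)
    (hwtop : Tendsto w (𝓝[>] 0) atTop) {t : ℝ} (ht : 0 < t) : hittingTime f θ (w t) = t := by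
  have hd : ∀ s > 0, HasDerivAt (fun s => hittingTime f θ (w s) - s) 0 s := by
    intro s hs
    have h1 := ((hasDerivAt_hittingTime hθ hf hpos (hw0 s hs)).comp s (hw s hs)).sub
      (hasDerivAt_id s)
    have h2 : -(f (w s))⁻¹ * -f (w s) - 1 = 0 := by
      rw [neg_mul_neg, inv_mul_cancel₀ (hpos _ (hw0 s hs)).ne', sub_self]
    rw [h2] at h1
    exact h1
  obtain ⟨c, hc⟩ := isOpen_Ioi.exists_is_const_of_deriv_eq_zero isPreconnected_Ioi
    (fun s hs => (hd s hs).differentiableAt.differentiableWithinAt) (fun s hs => (hd s hs).deriv)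
  have hlim : Tendsto (fun s => hittingTime f θ (w s) - s) (𝓝[>] 0) (𝓝 (0 - 0)) :=
    ((tendsto_hittingTime_atTop hint).comp hwtop).sub (tendsto_id.mono_left nhdsWithin_le_nhds)
  have hlim' : Tendsto (fun s => hittingTime f θ (w s) - s) (𝓝[>] 0) (𝓝 c) :=
    tendsto_const_nhds.congr' <| by
      filter_upwards [self_mem_nhdsWithin] with s hs
      exact (hc s hs).symm
  have hc0 := tendsto_nhds_unique hlim hlim'
  have := hc t ht
  linarith

/-- Coming down from infinity: existence, uniqueness and monotonicity of the solution of
`v' = -f v` with `v (0+) = ∞`. -/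
theorem exists_unique_solution_from_infinity (hθ : 0 < θ) (hf : ContinuousOn f (Ioi 0))
    (hpos : ∀ x > 0, 0 < f x) (hint : IntegrableOn (fun y => (f y)⁻¹) (Ioi θ))
    {C : ℝ} (hC : 0 < C) (hle : ∀ x ∈ Ioo 0 θ, f x ≤ C * x) :
    ∃ v : ℝ → ℝ, ((∀ t > 0, 0 < v t) ∧ (∀ t > 0, HasDerivAt v (-f (v t)) t) ∧
        Tendsto v (𝓝[>] 0) atTop) ∧
      (∀ w : ℝ → ℝ, ((∀ t > 0, 0 < w t) ∧ (∀ t > 0, HasDerivAt w (-f (w t)) t) ∧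
        Tendsto w (𝓝[>] 0) atTop) → ∀ t > 0, w t = v t) ∧
      AntitoneOn v (Ioi 0) := by
  have hex : ∀ t : ℝ, ∃ x, 0 < t → 0 < x ∧ hittingTime f θ x = t := fun t => by
    by_cases ht : 0 < t
    · obtain ⟨x, hx, hxt⟩ := exists_hittingTime_eq hθ hf hpos hint hC hle ht
      exact ⟨x, fun _ => ⟨hx, hxt⟩⟩
    · exact ⟨0, fun h => absurd h ht⟩
  choose v hv using hex
  have hT := strictAntiOn_hittingTime hθ hf hpos
  have hanti : AntitoneOn v (Ioi 0) := by
    intro s hs t ht hst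
    rw [← hT.le_iff_ge (hv s hs).1 (hv t ht).1, (hv s hs).2, (hv t ht).2]
    exact hst
  have hcont : ∀ t > 0, ContinuousAt v t := by
    intro t ht
    have h : ContinuousAt (fun s => -v s) t := by
      refine continuousAt_of_monotoneOn_of_image_mem_nhds hanti.neg (Ioi_mem_nhds ht)
        (mem_of_superset (Iio_mem_nhds (neg_neg_of_pos (hv t ht).1)) ?_)
      intro y hy
      have hy' : 0 < -y := neg_pos.2 hy
      have hs := hittingTime_pos hθ hf hpos hint hy'
      refine ⟨_, hs, ?_⟩
      have := hT.injOn (hv _ hs).1 hy' (hv _ hs).2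
      simp [this]
    exact h.neg.congr (Eventually.of_forall fun s => neg_neg (v s))
  refine ⟨v, ⟨fun t ht => (hv t ht).1, fun t ht => ?_, ?_⟩, fun w hw t ht => ?_, hanti⟩
  · have hne : -(f (v t))⁻¹ ≠ 0 := neg_ne_zero.2 (inv_ne_zero (hpos _ (hv t ht).1).ne')
    have := HasDerivAt.of_local_left_inverse (hcont t ht)
      (hasDerivAt_hittingTime hθ hf hpos (hv t ht).1) hne
      (by filter_upwards [Ioi_mem_nhds ht] with s hs; exact (hv s hs).2)
    rwa [inv_neg, inv_inv] at this
  · refine tendsto_atTop.2 fun M => ?_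
    have hM : (0 : ℝ) < max M 1 := lt_max_of_lt_right one_pos
    filter_upwards [Ioo_mem_nhdsGT (hittingTime_pos hθ hf hpos hint hM)] with t ht
    refine (le_max_left M 1).trans ?_
    rw [← hT.le_iff_ge (hv t ht.1).1 hM, (hv t ht.1).2]
    exact ht.2.le
  · refine hT.injOn (hw.1 t ht) (hv t ht).1 ?_
    rw [(hv t ht).2]
    exact hittingTime_solution hθ hf hpos hint hw.1 hw.2.1 hw.2.2 ht

end AutonomousODE

/-- Existence, uniqueness and monotonicity of the minimal extinction solution `v̄`
under Grey's condition. -/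
theorem vbar_exists_unique
    (a₁ α₁₁ α₁₂ : ℝ) (m : Measure (ℝ × ℝ))
    (hα₁₁ : 0 ≤ α₁₁) (hα₁₂ : 0 ≤ α₁₂)
    (hm_supp : m {z : ℝ × ℝ | z.1 < 0 ∨ z = 0} = 0)
    (hm_int : ∫⁻ z : ℝ × ℝ, ENNReal.ofReal (min z.1 (z.1 ^ 2) + z.2 ^ 2) ∂m < ⊤)
    (ha₁ : 0 < a₁) (hA : CondA a₁ α₁₁ α₁₂ m) :
    ∃ v : ℝ → ℝ, IsVbar a₁ α₁₁ α₁₂ m v ∧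
      (∀ w : ℝ → ℝ, IsVbar a₁ α₁₁ α₁₂ m w → ∀ t > (0:ℝ), w t = v t) ∧
      AntitoneOn v (Set.Ioi 0) := by
  obtain ⟨θ, hθ, -, hfin⟩ := hA
  have hf := continuousOn_phi0 a₁ α₁₁ α₁₂ hm_supp hm_int
  have hpos : ∀ x > 0, 0 < phi0 a₁ α₁₁ α₁₂ m x := fun x hx => phi0_pos ha₁ hα₁₁ hα₁₂ hx
  have hint : IntegrableOn (fun y => (phi0 a₁ α₁₁ α₁₂ m y)⁻¹) (Ici θ) := by
    have hsub : Ici θ ⊆ Ioi (0 : ℝ) := fun y hy => hθ.trans_le hy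
    refine ⟨((hf.inv₀ fun y hy => (hpos y hy).ne').mono hsub).aestronglyMeasurable
      measurableSet_Ici, ?_⟩
    rw [hasFiniteIntegral_iff_ofReal]
    · exact hfin
    · filter_upwards [ae_restrict_mem measurableSet_Ici] with y hy
      exact (inv_pos.2 (hpos y (hsub hy))).le
  have hI : 0 ≤ ∫ z : ℝ × ℝ, min z.1 (z.1 ^ 2) ∂m := by
    refine integral_nonneg_of_ae ?_
    filter_upwards [ae_fst_nonneg hm_supp] with z hz
    exact le_min hz (sq_nonneg _)
  have hK : 0 < a₁ + (α₁₁ + α₁₂) + ∫ z : ℝ × ℝ, min z.1 (z.1 ^ 2) ∂m := by positivity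
  refine exists_unique_solution_from_infinity hθ hf hpos (hint.mono_set Ioi_subset_Ici_self)
    (mul_pos hK (add_pos one_pos hθ)) fun x hx => ?_
  refine (phi0_le ha₁ hα₁₁ hα₁₂ hm_supp hm_int hx.1.le).trans ?_
  rw [mul_assoc]
  refine mul_le_mul_of_nonneg_left ?_ hK.le
  nlinarith [hx.1, hx.2]

end AffinePaper
end
end

section
/- First moment of the stationary distribution in the first coordinate. Assume a₁ > 0, b₂ > 0, and ∫_{{z₁>1}} z₁ n(dz) < ∞, and let π be the unique stationary (invariant) distribution of (P_t)_{t≥0}. Then ∫_G y₁ π(dy) = a₁^{−1} ( a₂ + ∫_G z₁ n(dz) ) < ∞. -/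
open MeasureTheory Filter Set Topology
open scoped ENNReal Classical

noncomputable section

namespace AffinePaper

/-! ### Elementary bounds for the complex exponential on the left half-plane -/

lemma convex_re_nonpos : Convex ℝ {w : ℂ | w.re ≤ 0} :=
  convex_halfSpace_re_le 0

lemma norm_exp_sub_one_le_of_re_nonpos {w : ℂ} (hw : w.re ≤ 0) :
    ‖Complex.exp w - 1‖ ≤ ‖w‖ := by
  have h := convex_re_nonpos.norm_image_sub_le_of_norm_hasDerivWithin_le
    (f := Complex.exp) (f' := Complex.exp) (C := 1) (x := 0) (y := w)
    (fun x _ => (Complex.hasDerivAt_exp x).hasDerivWithinAt)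
    (fun x hx => by rw [Complex.norm_exp]; exact Real.exp_le_one_iff.2 hx) (by simp) hw
  simpa using h

lemma norm_exp_sub_one_sub_le_of_re_nonpos {w : ℂ} (hw : w.re ≤ 0) :
    ‖Complex.exp w - 1 - w‖ ≤ ‖w‖ ^ 2 := by
  have hconv : Convex ℝ ({x : ℂ | x.re ≤ 0} ∩ Metric.closedBall 0 ‖w‖) :=
    convex_re_nonpos.inter (convex_closedBall _ _)
  have h := hconv.norm_image_sub_le_of_norm_hasDerivWithin_le
    (f := fun x => Complex.exp x - 1 - x) (f' := fun x => Complex.exp x - 1) (C := ‖w‖)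
    (x := 0) (y := w)
    (fun x _ => (((Complex.hasDerivAt_exp x).sub_const 1).sub (hasDerivAt_id x)).hasDerivWithinAt)
    (fun x hx => (norm_exp_sub_one_le_of_re_nonpos hx.1).trans (by simpa using hx.2))
    (by simp) ⟨hw, by simp⟩
  simpa [sq] using h

lemma norm_exp_mul_sub_one_sub_le {v : ℂ} (hv : v.re ≤ 0) (hv1 : ‖v‖ ≤ 1) {x : ℝ} (hx : 0 ≤ x) :
    ‖Complex.exp (v * x) - 1 - v * x‖ ≤ 2 * ‖v‖ * min x (x ^ 2) := by
  have hw : (v * (x : ℂ)).re ≤ 0 := by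
    simpa using mul_nonpos_of_nonpos_of_nonneg hv hx
  have hn : ‖v * (x : ℂ)‖ = ‖v‖ * x := by simp [abs_of_nonneg hx]
  have h1 : ‖Complex.exp (v * x) - 1 - v * x‖ ≤ 2 * ‖v‖ * x := by
    have := norm_sub_le (Complex.exp (v * x) - 1) (v * x)
    have := norm_exp_sub_one_le_of_re_nonpos hw
    linarith
  have h2 : ‖Complex.exp (v * x) - 1 - v * x‖ ≤ 2 * ‖v‖ * x ^ 2 := by
    have h := norm_exp_sub_one_sub_le_of_re_nonpos hw
    rw [hn] at h
    have : ‖v‖ ^ 2 ≤ 2 * ‖v‖ := by nlinarith [norm_nonneg v]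
    nlinarith [mul_le_mul_of_nonneg_right this (sq_nonneg x)]
  rcases min_cases x (x ^ 2) with h | h <;> rw [h.1] <;> assumption

lemma re_conj_mul_exp_sub_one_sub_nonpos {v : ℂ} (hv : v.re ≤ 0) {x : ℝ} (hx : 0 ≤ x) :
    ((starRingEnd ℂ) v * (Complex.exp (v * x) - 1 - v * x)).re ≤ 0 := by
  have hw : (v * (x : ℂ)).re ≤ 0 := by
    simpa using mul_nonpos_of_nonpos_of_nonneg hv hx
  have h1 : ((starRingEnd ℂ) v * (Complex.exp (v * x) - 1)).re ≤ ‖v‖ * (‖v‖ * x) := by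
    refine (Complex.re_le_norm _).trans ?_
    rw [norm_mul, Complex.norm_conj]
    gcongr
    refine (norm_exp_sub_one_le_of_re_nonpos hw).trans_eq ?_
    simp [abs_of_nonneg hx]
  have h2 : ((starRingEnd ℂ) v * (v * x)).re = ‖v‖ * (‖v‖ * x) := by
    rw [← mul_assoc, ← Complex.normSq_eq_conj_mul_self, ← Complex.ofReal_mul, Complex.ofReal_re,
      Complex.normSq_eq_norm_sq]
    ring
  rw [mul_sub, Complex.sub_re, h2]
  linarith

/-! ### Integrals of the exponential against a Lévy measure -/

lemma integral_exp_sub_one_sub_isLittleO {μ : Measure (ℝ × ℝ)} (hμ : ∀ᵐ z ∂μ, 0 ≤ z.1)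
    (hint : Integrable (fun z : ℝ × ℝ => min z.1 (z.1 ^ 2)) μ) :
    (fun v : ℂ => ∫ z : ℝ × ℝ, (Complex.exp (v * z.1) - 1 - v * z.1) ∂μ)
      =o[𝓝[{w : ℂ | w.re ≤ 0}] 0] fun v => v := by
  have hball : ∀ᶠ v : ℂ in 𝓝[{w : ℂ | w.re ≤ 0}] 0, ‖v‖ ≤ 1 := by
    refine mem_nhdsWithin_of_mem_nhds ?_
    filter_upwards [Metric.closedBall_mem_nhds (0 : ℂ) one_pos] with v hv
    simpa using hv
  rw [Asymptotics.isLittleO_iff_tendsto' (Eventually.of_forall fun v hv => by simp [hv])]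
  simp_rw [← integral_div]
  rw [show 𝓝 (0 : ℂ) = 𝓝 (∫ _ : ℝ × ℝ, (0 : ℂ) ∂μ) by simp]
  refine tendsto_integral_filter_of_dominated_convergence
    (fun z => 2 * min z.1 (z.1 ^ 2)) (Eventually.of_forall fun v => by fun_prop) ?_
    (hint.const_mul 2) ?_
  · filter_upwards [hball, self_mem_nhdsWithin] with v hv1 hv
    filter_upwards [hμ] with z hz
    rw [norm_div]
    refine div_le_of_le_mul₀ (norm_nonneg _) (by positivity) ?_
    linarith [norm_exp_mul_sub_one_sub_le hv hv1 hz]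
  · filter_upwards [hμ] with z hz
    have hlim : Tendsto (fun v : ℂ => ‖v‖ * z.1 ^ 2) (𝓝[{w : ℂ | w.re ≤ 0}] 0) (𝓝 0) := by
      have : Continuous fun v : ℂ => ‖v‖ * z.1 ^ 2 := by fun_prop
      simpa using (this.tendsto 0).mono_left nhdsWithin_le_nhds
    refine squeeze_zero_norm' ?_ hlim
    filter_upwards [self_mem_nhdsWithin] with v hv
    rw [norm_div]
    refine div_le_of_le_mul₀ (norm_nonneg _) (by positivity) ?_
    have hw : (v * (z.1 : ℂ)).re ≤ 0 := by
      simpa using mul_nonpos_of_nonpos_of_nonneg hv hz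
    refine (norm_exp_sub_one_sub_le_of_re_nonpos hw).trans_eq ?_
    simp [abs_of_nonneg hz]
    ring

lemma re_conj_mul_integral_exp_sub_one_sub_nonpos {μ : Measure (ℝ × ℝ)}
    (hμ : ∀ᵐ z ∂μ, 0 ≤ z.1) {v : ℂ} (hv : v.re ≤ 0) :
    ((starRingEnd ℂ) v * ∫ z : ℝ × ℝ, (Complex.exp (v * z.1) - 1 - v * z.1) ∂μ).re ≤ 0 := by
  rw [← integral_const_mul]
  by_cases h : Integrable
      (fun z : ℝ × ℝ => (starRingEnd ℂ) v * (Complex.exp (v * z.1) - 1 - v * z.1)) μ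
  · have := integral_re h
    simp only [RCLike.re_eq_complex_re] at this
    rw [← this]
    refine integral_nonpos_of_ae ?_
    filter_upwards [hμ] with z hz
    exact re_conj_mul_exp_sub_one_sub_nonpos hv hz
  · simp [integral_undef h]

lemma integrable_exp_sub_one {μ : Measure (ℝ × ℝ)} (hμ : ∀ᵐ z ∂μ, 0 ≤ z.1)
    (hint : Integrable (fun z : ℝ × ℝ => z.1) μ) {v : ℂ} (hv : v.re ≤ 0) :
    Integrable (fun z : ℝ × ℝ => Complex.exp (v * z.1) - 1) μ := by
  refine (hint.const_mul ‖v‖).mono' (by fun_prop) ?_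
  filter_upwards [hμ] with z hz
  have hw : (v * (z.1 : ℂ)).re ≤ 0 := by
    simpa using mul_nonpos_of_nonpos_of_nonneg hv hz
  refine (norm_exp_sub_one_le_of_re_nonpos hw).trans_eq ?_
  simp [abs_of_nonneg hz]

lemma continuousOn_integral_exp_sub_one {μ : Measure (ℝ × ℝ)} (hμ : ∀ᵐ z ∂μ, 0 ≤ z.1)
    (hint : Integrable (fun z : ℝ × ℝ => z.1) μ) :
    ContinuousOn (fun v : ℂ => ∫ z : ℝ × ℝ, (Complex.exp (v * z.1) - 1) ∂μ)
      {w : ℂ | w.re ≤ 0} := by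
  intro v₀ _
  refine continuousWithinAt_of_dominated (bound := fun z => (‖v₀‖ + 1) * z.1)
    (Eventually.of_forall fun v => by fun_prop) ?_ (hint.const_mul _)
    (ae_of_all _ fun z => by fun_prop)
  have hball : ∀ᶠ v : ℂ in 𝓝[{w : ℂ | w.re ≤ 0}] v₀, ‖v‖ < ‖v₀‖ + 1 :=
    mem_nhdsWithin_of_mem_nhds
      (continuous_norm.continuousAt.eventually (gt_mem_nhds (lt_add_one ‖v₀‖)))
  filter_upwards [hball, self_mem_nhdsWithin] with v hv1 hv
  filter_upwards [hμ] with z hz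
  have hw : (v * (z.1 : ℂ)).re ≤ 0 := by
    simpa using mul_nonpos_of_nonpos_of_nonneg hv hz
  refine (norm_exp_sub_one_le_of_re_nonpos hw).trans ?_
  rw [norm_mul, Complex.norm_real, Real.norm_of_nonneg hz]
  gcongr

/-! ### First moments from characteristic functions -/

lemma integral_sin_mul (θ y : ℝ) :
    ∫ s in (0 : ℝ)..θ, Real.sin (s * y) = (1 - Real.cos (θ * y)) / y := by
  rcases eq_or_ne y 0 with rfl | hy
  · simp
  · rw [intervalIntegral.integral_comp_mul_right _ hy]
    simp [div_eq_inv_mul]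

lemma tendsto_one_sub_cos_div (y : ℝ) :
    Tendsto (fun θ : ℝ => (1 - Real.cos (θ * y)) / y / θ ^ 2) (𝓝[>] 0) (𝓝 (y / 2)) := by
  rcases eq_or_ne y 0 with rfl | hy
  · simp
  have hsin : HasDerivAt (fun θ : ℝ => Real.sin (θ * (y / 2))) (y / 2) 0 := by
    have := ((hasDerivAt_id (0 : ℝ)).mul_const (y / 2)).sin
    simpa using this
  have h := (hasDerivAt_iff_tendsto_slope.1 hsin).mono_left
    (nhdsWithin_mono (0 : ℝ) (t := {0}ᶜ) (s := Set.Ioi 0) fun x hx => (Set.mem_Ioi.1 hx).ne')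
  have h2 := (h.pow 2).const_mul (2 / y)
  have he : 2 / y * (y / 2) ^ 2 = y / 2 := by field_simp
  rw [he] at h2
  refine h2.congr' ?_
  filter_upwards [self_mem_nhdsWithin] with θ (hθ : 0 < θ)
  have hc : Real.cos (θ * y) = 1 - 2 * Real.sin (θ * (y / 2)) ^ 2 := by
    rw [show θ * y = 2 * (θ * (y / 2)) by ring, Real.cos_two_mul, Real.cos_sq']
    ring
  simp only [slope_def_field, hc, zero_mul, Real.sin_zero, sub_zero]
  field_simp
  ring

/-- For a probability measure on the half-line, one-sided differentiability at zero of the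
imaginary part of the characteristic function gives a finite first moment. -/
lemma first_moment_of_tendsto_sin {μ : Measure ℝ} [IsProbabilityMeasure μ]
    (hμ : ∀ᵐ y ∂μ, 0 ≤ y) {M : ℝ}
    (h : Tendsto (fun θ : ℝ => (∫ y, Real.sin (θ * y) ∂μ) / θ) (𝓝[>] 0) (𝓝 M)) :
    Integrable (fun y => y) μ ∧ ∫ y, y ∂μ = M := by
  have hcont : Continuous fun θ : ℝ => ∫ y, Real.sin (θ * y) ∂μ :=
    continuous_of_dominated (bound := fun _ => 1) (fun θ => by fun_prop)
      (fun θ => ae_of_all _ fun y => Real.abs_sin_le_one _) (integrable_const _)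
      (ae_of_all _ fun y => by fun_prop)
  have hswap (θ : ℝ) : ∫ y, (1 - Real.cos (θ * y)) / y ∂μ
      = ∫ s in (0 : ℝ)..θ, ∫ y, Real.sin (s * y) ∂μ := by
    simp_rw [← integral_sin_mul]
    refine (intervalIntegral_integral_swap ?_).symm
    have : IsFiniteMeasure ((volume : Measure ℝ).restrict (Set.uIoc 0 θ)) :=
      ⟨by simp [Set.uIoc]⟩
    exact Integrable.of_bound (C := 1) (by simp only [Function.uncurry_def]; fun_prop)
      (ae_of_all _ fun p => Real.abs_sin_le_one _)
  have havg : Tendsto (fun θ : ℝ => ∫ y, (1 - Real.cos (θ * y)) / y / θ ^ 2 ∂μ)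
      (𝓝[>] 0) (𝓝 (M / 2)) := by
    simp_rw [integral_div, hswap]
    rw [Metric.tendsto_nhdsWithin_nhds] at h ⊢
    intro ε hε
    obtain ⟨δ, hδ, hd⟩ := h (ε / 2) (by positivity)
    refine ⟨δ, hδ, fun {θ} (hθ : 0 < θ) hθδ => ?_⟩
    rw [Real.dist_eq, sub_zero, abs_of_pos hθ] at hθδ
    have hM : ∫ s in (0 : ℝ)..θ, s * M = θ ^ 2 * (M / 2) := by
      rw [intervalIntegral.integral_mul_const, integral_id]
      ring
    have hb : ‖∫ s in (0 : ℝ)..θ, ((∫ y, Real.sin (s * y) ∂μ) - s * M)‖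
        ≤ (ε / 2 * θ) * |θ - 0| := by
      refine intervalIntegral.norm_integral_le_of_norm_le_const fun s hs => ?_
      rw [Set.uIoc_of_le hθ.le] at hs
      have h1 := hd (x := s) hs.1 (by
        rw [Real.dist_eq, sub_zero, abs_of_pos hs.1]; linarith [hs.2])
      rw [Real.dist_eq] at h1
      have h2 : (∫ y, Real.sin (s * y) ∂μ) - s * M
          = s * ((∫ y, Real.sin (s * y) ∂μ) / s - M) := by
        have := hs.1.ne'
        field_simp
      rw [h2, Real.norm_eq_abs, abs_mul, abs_of_pos hs.1]
      nlinarith [hs.1, hs.2]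
    rw [intervalIntegral.integral_sub (hcont.intervalIntegrable _ _)
      ((by fun_prop : Continuous fun s : ℝ => s * M).intervalIntegrable _ _), hM, sub_zero,
      abs_of_pos hθ, Real.norm_eq_abs] at hb
    rw [Real.dist_eq]
    have h3 : (∫ s in (0 : ℝ)..θ, ∫ y, Real.sin (s * y) ∂μ) / θ ^ 2 - M / 2
        = ((∫ s in (0 : ℝ)..θ, ∫ y, Real.sin (s * y) ∂μ) - θ ^ 2 * (M / 2)) / θ ^ 2 := by
      field_simp
    rw [h3, abs_div, abs_of_pos (by positivity : 0 < θ ^ 2), div_lt_iff₀ (by positivity)]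
    nlinarith [sq_pos_of_pos hθ]
  have hseq : Tendsto (fun k : ℕ => 1 / ((k : ℝ) + 1)) atTop (𝓝[>] 0) :=
    tendsto_nhdsWithin_iff.2 ⟨tendsto_one_div_add_atTop_nhds_zero_nat,
      Eventually.of_forall fun k => Set.mem_Ioi.2 (by positivity)⟩
  have hK (θ y : ℝ) (hy : 0 ≤ y) : 0 ≤ (1 - Real.cos (θ * y)) / y / θ ^ 2 := by
    have := Real.cos_le_one (θ * y)
    have : 0 ≤ 1 - Real.cos (θ * y) := by linarith
    positivity
  have hKint (θ : ℝ) : Integrable (fun y => (1 - Real.cos (θ * y)) / y / θ ^ 2) μ := by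
    refine Integrable.div_const (Integrable.of_bound (C := |θ|)
      (Measurable.aestronglyMeasurable (by fun_prop))
      (ae_of_all _ fun y => ?_)) _
    rw [← integral_sin_mul]
    refine (intervalIntegral.norm_integral_le_of_norm_le_const (C := 1)
      fun s _ => Real.abs_sin_le_one _).trans_eq ?_
    simp
  have hhalf : Integrable (fun y => y / 2) μ := by
    refine integrable_of_tendsto
      (G := fun k y => (1 - Real.cos (1 / ((k : ℝ) + 1) * y)) / y / (1 / ((k : ℝ) + 1)) ^ 2)
      (ae_of_all _ fun y => (tendsto_one_sub_cos_div y).comp hseq)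
      (fun k => (hKint _).aestronglyMeasurable) ?_
    have hlin (k : ℕ) :
        ∫⁻ y, ‖(1 - Real.cos (1 / ((k : ℝ) + 1) * y)) / y / (1 / ((k : ℝ) + 1)) ^ 2‖ₑ ∂μ
        = ENNReal.ofReal
          (∫ y, (1 - Real.cos (1 / ((k : ℝ) + 1) * y)) / y / (1 / ((k : ℝ) + 1)) ^ 2 ∂μ) := by
      rw [ofReal_integral_eq_lintegral_ofReal (hKint _)
        (by filter_upwards [hμ] with y hy using hK _ y hy)]
      refine lintegral_congr_ae ?_
      filter_upwards [hμ] with y hy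
      exact Real.enorm_of_nonneg (hK _ y hy)
    simp_rw [hlin]
    have := (ENNReal.tendsto_ofReal (havg.comp hseq)).liminf_eq
    simp only [Function.comp_def] at this
    rw [this]
    exact ENNReal.ofReal_ne_top
  have hid : Integrable (fun y => y) μ := by
    simpa [mul_div_cancel₀] using hhalf.mul_const 2
  refine ⟨hid, tendsto_nhds_unique ?_ h⟩
  simp_rw [← integral_div]
  refine tendsto_integral_filter_of_dominated_convergence (fun y => ‖y‖)
    (Eventually.of_forall fun θ => by fun_prop) ?_ hid.norm (ae_of_all _ fun y => ?_)
  · filter_upwards [self_mem_nhdsWithin] with θ (hθ : 0 < θ)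
    refine ae_of_all _ fun y => ?_
    rw [norm_div, Real.norm_of_nonneg hθ.le]
    refine div_le_of_le_mul₀ hθ.le (norm_nonneg _) ?_
    have := Real.abs_sin_le_abs (x := θ * y)
    rwa [abs_mul, abs_of_pos hθ, mul_comm θ |y|] at this
  · have hsin : HasDerivAt (fun θ : ℝ => Real.sin (θ * y)) y 0 := by
      have := ((hasDerivAt_id (0 : ℝ)).mul_const y).sin
      simpa using this
    refine ((hasDerivAt_iff_tendsto_slope.1 hsin).mono_left
      (nhdsWithin_mono (0 : ℝ) (t := {0}ᶜ) (s := Set.Ioi 0) fun x hx => (Set.mem_Ioi.1 hx).ne')).congr fun θ => ?_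
    simp [slope_def_field]

/-! ### The semigroup along the first coordinate -/

lemma phi_zero_right (a₁ b₁ α₁₁ α₁₂ α₂₁ α₂₂ : ℝ) (m : Measure (ℝ × ℝ)) (v : ℂ) :
    phi a₁ b₁ α₁₁ α₁₂ α₂₁ α₂₂ m (v, 0) = -(a₁ : ℂ) * v + ((α₁₁ + α₁₂ : ℝ) : ℂ) * v ^ 2
      + ∫ z : ℝ × ℝ, (Complex.exp (v * z.1) - 1 - v * z.1) ∂m := by
  simp [phi]

lemma psi_zero_right (a₂ b₀ σ : ℝ) (n : Measure (ℝ × ℝ)) (v : ℂ) :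
    psi a₂ b₀ σ n (v, 0) = (a₂ : ℂ) * v
      + ∫ z : ℝ × ℝ, (Complex.exp (v * z.1) - 1) ∂n := by
  simp [psi]

lemma ae_fst_nonneg_s9 {μ : Measure (ℝ × ℝ)} (h : μ {x : ℝ × ℝ | x.1 < 0} = 0) :
    ∀ᵐ x ∂μ, 0 ≤ x.1 := by
  simpa [ae_iff] using h

namespace AffineSemigroup

variable (S : AffineSemigroup)

lemma ae_m_fst_nonneg : ∀ᵐ z ∂S.m, 0 ≤ z.1 :=
  ae_fst_nonneg_s9 (measure_mono_null (fun _ hz => Or.inl hz) S.m_supp)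

lemma ae_n_fst_nonneg : ∀ᵐ z ∂S.n, 0 ≤ z.1 :=
  ae_fst_nonneg_s9 (measure_mono_null (fun _ hz => Or.inl hz) S.n_supp)

lemma integrable_m_min : Integrable (fun z : ℝ × ℝ => min z.1 (z.1 ^ 2)) S.m := by
  refine ⟨by fun_prop, lt_of_le_of_lt (lintegral_mono_ae ?_) S.m_int⟩
  filter_upwards [S.ae_m_fst_nonneg] with z hz
  rw [Real.enorm_of_nonneg (le_min hz (sq_nonneg _))]
  exact ENNReal.ofReal_le_ofReal (le_add_of_nonneg_right (sq_nonneg _))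

lemma integrable_n_fst
    (h : ∫⁻ z in {z : ℝ × ℝ | 1 < z.1}, ENNReal.ofReal z.1 ∂S.n < ⊤) :
    Integrable (fun z : ℝ × ℝ => z.1) S.n := by
  have hmeas : MeasurableSet {z : ℝ × ℝ | 1 < z.1} := measurableSet_lt (by fun_prop) (by fun_prop)
  refine ⟨by fun_prop, ?_⟩
  rw [HasFiniteIntegral, ← lintegral_add_compl _ hmeas, ENNReal.add_lt_top]
  constructor
  · refine lt_of_le_of_lt (setLIntegral_mono' hmeas fun z hz => ?_) h
    rw [Real.enorm_of_nonneg (zero_le_one.trans hz.le)]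
  · refine lt_of_le_of_lt (lintegral_mono_ae (g := fun z : ℝ × ℝ =>
      ENNReal.ofReal (min 1 z.1 + min |z.2| (z.2 ^ 2))) ?_)
      (lt_of_le_of_lt (setLIntegral_le_lintegral _ _) S.n_int)
    filter_upwards [ae_restrict_of_ae S.ae_n_fst_nonneg, ae_restrict_mem hmeas.compl] with z hz hz1
    rw [Real.enorm_of_nonneg hz, min_eq_right (not_lt.1 (Set.mem_compl_iff _ _ |>.1 hz1))]
    exact ENNReal.ofReal_le_ofReal
      (le_add_of_nonneg_right (le_min (abs_nonneg _) (sq_nonneg _)))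

lemma integrable_n_min (hn : Integrable (fun z : ℝ × ℝ => z.1) S.n) :
    Integrable (fun z : ℝ × ℝ => min z.1 (z.1 ^ 2)) S.n := by
  refine hn.mono' (by fun_prop) ?_
  filter_upwards [S.ae_n_fst_nonneg] with z hz
  rw [Real.norm_of_nonneg (le_min hz (sq_nonneg _))]
  exact min_le_left _ _

lemma hasDerivAt_V₁ {v : ℂ} (hv : v.re ≤ 0) {t : ℝ} (ht : 0 ≤ t) :
    HasDerivAt (fun s => S.V₁ s (v, 0))
      (phi S.a₁ S.b₁ S.α₁₁ S.α₁₂ S.α₂₁ S.α₂₂ S.m (S.V₁ t (v, 0), 0)) t := by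
  simpa using S.V₁_ode (v, 0) hv rfl t ht

lemma re_V₁_nonpos {v : ℂ} (hv : v.re ≤ 0) {t : ℝ} (ht : 0 ≤ t) : (S.V₁ t (v, 0)).re ≤ 0 :=
  S.V₁_mem (v, 0) hv rfl t ht

lemma continuousOn_V₁ {v : ℂ} (hv : v.re ≤ 0) :
    ContinuousOn (fun t => S.V₁ t (v, 0)) (Set.Ici 0) :=
  fun _ ht => (S.hasDerivAt_V₁ hv ht).continuousAt.continuousWithinAt

lemma re_conj_mul_phi_le {v : ℂ} (hv : v.re ≤ 0) :
    ((starRingEnd ℂ) v * phi S.a₁ S.b₁ S.α₁₁ S.α₁₂ S.α₂₁ S.α₂₂ S.m (v, 0)).re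
      ≤ -S.a₁ * ‖v‖ ^ 2 := by
  rw [phi_zero_right, mul_add, mul_add, Complex.add_re, Complex.add_re]
  have h1 := re_conj_mul_integral_exp_sub_one_sub_nonpos S.ae_m_fst_nonneg hv
  have hn : (starRingEnd ℂ) v * v = ((‖v‖ ^ 2 : ℝ) : ℂ) := by
    rw [← Complex.normSq_eq_conj_mul_self, Complex.normSq_eq_norm_sq]
  have h2 : ((starRingEnd ℂ) v * (-(S.a₁ : ℂ) * v)).re = -S.a₁ * ‖v‖ ^ 2 := by
    rw [mul_left_comm, hn, ← Complex.ofReal_neg, ← Complex.ofReal_mul, Complex.ofReal_re]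
  have h3 : ((starRingEnd ℂ) v * (((S.α₁₁ + S.α₁₂ : ℝ) : ℂ) * v ^ 2)).re ≤ 0 := by
    rw [show (starRingEnd ℂ) v * (((S.α₁₁ + S.α₁₂ : ℝ) : ℂ) * v ^ 2)
      = ((S.α₁₁ + S.α₁₂ : ℝ) : ℂ) * (((starRingEnd ℂ) v * v) * v) by ring, hn,
      Complex.re_ofReal_mul, Complex.re_ofReal_mul]
    exact mul_nonpos_of_nonneg_of_nonpos (add_nonneg S.α₁₁_nonneg S.α₁₂_nonneg)
      (mul_nonpos_of_nonneg_of_nonpos (sq_nonneg _) hv)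
  linarith

lemma norm_V₁_le {v : ℂ} (hv : v.re ≤ 0) {t : ℝ} (ht : 0 ≤ t) :
    ‖S.V₁ t (v, 0)‖ ≤ ‖v‖ * Real.exp (-S.a₁ * t) := by
  have hderiv (s : ℝ) (hs : 0 ≤ s) := ((((hasDerivAt_id s).const_mul (2 * S.a₁)).exp).mul
    (S.hasDerivAt_V₁ hv hs).norm_sq)
  have hanti : AntitoneOn
      (fun s : ℝ => Real.exp (2 * S.a₁ * s) * ‖S.V₁ s (v, 0)‖ ^ 2) (Set.Ici 0) := by
    refine antitoneOn_of_deriv_nonpos (convex_Ici 0)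
      (fun s hs => (hderiv s hs).continuousAt.continuousWithinAt)
      (fun s hs => ?_) (fun s hs => ?_)
    · rw [interior_Ici] at hs
      exact (hderiv s hs.le).differentiableAt.differentiableWithinAt
    · rw [interior_Ici] at hs
      refine (hderiv s hs.le).deriv.trans_le ?_
      have h := S.re_conj_mul_phi_le (S.re_V₁_nonpos hv hs.le)
      rw [mul_comm] at h
      simp only [Complex.inner, id]
      have := mul_le_mul_of_nonneg_left h (Real.exp_pos (2 * S.a₁ * s)).le
      linarith
  have h := hanti Set.self_mem_Ici ht ht
  simp only [S.V₁_init, mul_zero, Real.exp_zero, one_mul] at h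
  refine le_of_sq_le_sq ?_ (by positivity)
  have he : Real.exp (2 * S.a₁ * t) * Real.exp (-S.a₁ * t) ^ 2 = 1 := by
    rw [← Real.exp_nat_mul, ← Real.exp_add]
    simp
    ring
  rw [mul_pow]
  have := mul_le_mul_of_nonneg_right h (sq_nonneg (Real.exp (-S.a₁ * t)))
  calc ‖S.V₁ t (v, 0)‖ ^ 2
      = Real.exp (2 * S.a₁ * t) * Real.exp (-S.a₁ * t) ^ 2 * ‖S.V₁ t (v, 0)‖ ^ 2 := by
        rw [he, one_mul]
    _ ≤ _ := by linarith

/-- The accumulated immigration exponent `∫₀ᵗ ψ(V₁(s, v), 0) ds`. -/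
def immigrationExponent (t : ℝ) (v : ℂ) : ℂ :=
  ∫ s in (0 : ℝ)..t, psi S.a₂ S.b₀ S.σ S.n (S.V₁ s (v, 0), 0)

lemma continuousOn_psi_V₁ (hn : Integrable (fun z : ℝ × ℝ => z.1) S.n) {v : ℂ} (hv : v.re ≤ 0) :
    ContinuousOn (fun t => psi S.a₂ S.b₀ S.σ S.n (S.V₁ t (v, 0), 0)) (Set.Ici 0) := by
  simp_rw [psi_zero_right]
  exact ((continuousOn_const).mul (S.continuousOn_V₁ hv)).add
    ((continuousOn_integral_exp_sub_one S.ae_n_fst_nonneg hn).comp (S.continuousOn_V₁ hv)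
      fun t ht => S.re_V₁_nonpos hv ht)

lemma hasDerivWithinAt_immigrationExponent (hn : Integrable (fun z : ℝ × ℝ => z.1) S.n)
    {v : ℂ} (hv : v.re ≤ 0) {t : ℝ} (ht : 0 ≤ t) :
    HasDerivWithinAt (fun t => S.immigrationExponent t v)
      (psi S.a₂ S.b₀ S.σ S.n (S.V₁ t (v, 0), 0)) (Set.Ici t) t := by
  have hc := S.continuousOn_psi_V₁ hn hv
  have hsub : Set.Ici t ⊆ Set.Ici (0 : ℝ) := Set.Ici_subset_Ici.2 ht
  refine intervalIntegral.integral_hasDerivWithinAt_right (t := Set.Ioi t) ?_ ?_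
    ((hc t ht).mono (Set.Ioi_subset_Ici_self.trans hsub))
  · refine (hc.mono fun s hs => ?_).intervalIntegrable
    rw [Set.uIcc_of_le ht] at hs
    exact hs.1
  · exact (hc.mono (Set.Ioi_subset_Ici_self.trans hsub)).stronglyMeasurableAtFilter_nhdsWithin
      measurableSet_Ioi t

lemma continuousOn_immigrationExponent (hn : Integrable (fun z : ℝ × ℝ => z.1) S.n)
    {v : ℂ} (hv : v.re ≤ 0) (T : ℝ) :
    ContinuousOn (fun t => S.immigrationExponent t v) (Set.Icc 0 T) := by
  rcases le_or_gt 0 T with hT | hT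
  · have h := intervalIntegral.continuousOn_primitive_interval (μ := volume) (a := 0) (b := T)
      (f := fun t => psi S.a₂ S.b₀ S.σ S.n (S.V₁ t (v, 0), 0)) (by
        rw [Set.uIcc_of_le hT]
        exact ((S.continuousOn_psi_V₁ hn hv).mono Set.Icc_subset_Ici_self).integrableOn_Icc)
    rwa [Set.uIcc_of_le hT] at h
  · simp [Set.Icc_eq_empty_of_lt hT]

lemma psi_add_mul_phi_isLittleO (ha₁ : 0 < S.a₁) (hn : Integrable (fun z : ℝ × ℝ => z.1) S.n)
    {M : ℝ} (hM : M = S.a₁⁻¹ * (S.a₂ + ∫ z : ℝ × ℝ, z.1 ∂S.n)) :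
    (fun v : ℂ => psi S.a₂ S.b₀ S.σ S.n (v, 0)
      + M * phi S.a₁ S.b₁ S.α₁₁ S.α₁₂ S.α₂₁ S.α₂₂ S.m (v, 0))
      =o[𝓝[{w : ℂ | w.re ≤ 0}] 0] fun v => v := by
  have hsq : (fun v : ℂ => ((M * (S.α₁₁ + S.α₁₂) : ℝ) : ℂ) * v ^ 2)
      =o[𝓝[{w : ℂ | w.re ≤ 0}] 0] fun v => v :=
    ((Asymptotics.isLittleO_pow_id one_lt_two).const_mul_left _).mono nhdsWithin_le_nhds
  refine ((hsq.add
    ((integral_exp_sub_one_sub_isLittleO S.ae_m_fst_nonneg S.integrable_m_min).const_mul_left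
      (M : ℂ))).add
    (integral_exp_sub_one_sub_isLittleO S.ae_n_fst_nonneg (S.integrable_n_min hn))).congr'
    ?_ EventuallyEq.rfl
  filter_upwards [self_mem_nhdsWithin] with v hv
  have hint : ∫ z : ℝ × ℝ, (Complex.exp (v * z.1) - 1 - v * z.1) ∂S.n
      = (∫ z : ℝ × ℝ, (Complex.exp (v * z.1) - 1) ∂S.n)
        - v * ((∫ z : ℝ × ℝ, z.1 ∂S.n : ℝ) : ℂ) := by
    have hlin : Integrable (fun z : ℝ × ℝ => v * (z.1 : ℂ)) S.n := hn.ofReal.const_mul v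
    rw [integral_sub (integrable_exp_sub_one S.ae_n_fst_nonneg hn hv) hlin,
      integral_const_mul, integral_complex_ofReal]
  have hMa : (M : ℂ) * S.a₁ = S.a₂ + ((∫ z : ℝ × ℝ, z.1 ∂S.n : ℝ) : ℂ) := by
    rw [← Complex.ofReal_mul, ← Complex.ofReal_add, hM]
    congr 1
    field_simp
  rw [hint, psi_zero_right, phi_zero_right]
  push_cast
  linear_combination v * hMa

lemma norm_immigrationExponent_sub_le (ha₁ : 0 < S.a₁)
    (hn : Integrable (fun z : ℝ × ℝ => z.1) S.n) {M ε δ : ℝ} (hε : 0 ≤ ε)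
    (hδ : ∀ v : ℂ, v.re ≤ 0 → ‖v‖ < δ → ‖psi S.a₂ S.b₀ S.σ S.n (v, 0)
      + M * phi S.a₁ S.b₁ S.α₁₁ S.α₁₂ S.α₂₁ S.α₂₂ S.m (v, 0)‖ ≤ ε * ‖v‖)
    {v : ℂ} (hv : v.re ≤ 0) (hvδ : ‖v‖ < δ) {T : ℝ} (hT : 0 ≤ T) :
    ‖S.immigrationExponent T v - M * v‖
      ≤ ε * ‖v‖ / S.a₁ + |M| * (‖v‖ * Real.exp (-S.a₁ * T)) := by
  have hB (t : ℝ) : HasDerivAt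
      (fun t => ε * ‖v‖ / S.a₁ * (1 - Real.exp (-S.a₁ * t)))
      (ε * (‖v‖ * Real.exp (-S.a₁ * t))) t := by
    have := ((((hasDerivAt_id t).const_mul (-S.a₁)).exp).const_sub 1).const_mul (ε * ‖v‖ / S.a₁)
    refine this.congr_deriv ?_
    simp only [id]
    field_simp
  have h := image_norm_le_of_norm_deriv_right_le_deriv_boundary' (a := 0) (b := T)
    (f := fun t => S.immigrationExponent t v + M * (S.V₁ t (v, 0) - v))
    (f' := fun t => psi S.a₂ S.b₀ S.σ S.n (S.V₁ t (v, 0), 0)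
      + M * phi S.a₁ S.b₁ S.α₁₁ S.α₁₂ S.α₂₁ S.α₂₂ S.m (S.V₁ t (v, 0), 0))
    ((S.continuousOn_immigrationExponent hn hv T).add (continuousOn_const.mul
      (((S.continuousOn_V₁ hv).mono Set.Icc_subset_Ici_self).sub continuousOn_const)))
    (fun t ht => (S.hasDerivWithinAt_immigrationExponent hn hv ht.1).add
      ((((S.hasDerivAt_V₁ hv ht.1).sub_const v).const_mul (M : ℂ)).hasDerivWithinAt))
    (B := fun t => ε * ‖v‖ / S.a₁ * (1 - Real.exp (-S.a₁ * t)))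
    (B' := fun t => ε * (‖v‖ * Real.exp (-S.a₁ * t)))
    (by simp [immigrationExponent, S.V₁_init])
    (fun t _ => (hB t).continuousAt.continuousWithinAt)
    (fun t _ => (hB t).hasDerivWithinAt)
    (fun t ht => by
      have h1 := S.norm_V₁_le hv ht.1
      have h2 : Real.exp (-S.a₁ * t) ≤ 1 := Real.exp_le_one_iff.2 (by nlinarith [ht.1])
      refine (hδ _ (S.re_V₁_nonpos hv ht.1) ?_).trans (mul_le_mul_of_nonneg_left h1 hε)
      exact (h1.trans (mul_le_of_le_one_right (norm_nonneg _) h2)).trans_lt hvδ)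
    ⟨hT, le_rfl⟩
  have h1 : ε * ‖v‖ / S.a₁ * (1 - Real.exp (-S.a₁ * T)) ≤ ε * ‖v‖ / S.a₁ :=
    mul_le_of_le_one_right (by positivity) (by linarith [Real.exp_pos (-S.a₁ * T)])
  have h2 : ‖(M : ℂ) * S.V₁ T (v, 0)‖ ≤ |M| * (‖v‖ * Real.exp (-S.a₁ * T)) := by
    rw [norm_mul, Complex.norm_real, Real.norm_eq_abs]
    exact mul_le_mul_of_nonneg_left (S.norm_V₁_le hv hT) (abs_nonneg _)
  calc ‖S.immigrationExponent T v - M * v‖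
      = ‖(S.immigrationExponent T v + M * (S.V₁ T (v, 0) - v)) - M * S.V₁ T (v, 0)‖ := by
        congr 1
        ring
    _ ≤ _ := (norm_sub_le _ _).trans (add_le_add (h.trans h1) h2)

lemma integral_bind_P {π : Measure (ℝ × ℝ)} (hπ : IsStationary S.P π) {t : ℝ} (ht : 0 ≤ t)
    {f : ℝ × ℝ → ℂ} (hf : Integrable f π) : ∫ y, f y ∂π = ∫ x, ∫ y, f y ∂(S.P t x) ∂π := by
  obtain ⟨_, hsupp, hinv⟩ := hπ
  have hG : ∀ᵐ x ∂π, 0 ≤ x.1 := ae_fst_nonneg_s9 hsupp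
  have hmeas : MeasurableSet {x : ℝ × ℝ | 0 ≤ x.1} := measurableSet_le (by fun_prop) (by fun_prop)
  let κ : ProbabilityTheory.Kernel (ℝ × ℝ) (ℝ × ℝ) :=
    ⟨fun x => if 0 ≤ x.1 then S.P t x else Measure.dirac 0,
      Measurable.ite hmeas (S.P_meas t ht) measurable_const⟩
  have hκ_apply (x : ℝ × ℝ) (hx : 0 ≤ x.1) : κ x = S.P t x := if_pos hx
  have : ProbabilityTheory.IsMarkovKernel κ := ⟨fun x => by
    by_cases hx : 0 ≤ x.1
    · rw [hκ_apply x hx]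
      exact S.P_prob t ht x hx
    · rw [show κ x = Measure.dirac 0 from if_neg hx]
      infer_instance⟩
  have hbind : π.bind κ = π := by
    conv_rhs => rw [← hinv t ht]
    refine Measure.bind_congr_right ?_
    filter_upwards [hG] with x hx using hκ_apply x hx
  have hcomp : (κ.comp (ProbabilityTheory.Kernel.const Unit π)) () = π := by
    rw [ProbabilityTheory.Kernel.comp_apply, ProbabilityTheory.Kernel.const_apply, hbind]
  have h := ProbabilityTheory.Kernel.integral_comp (by rwa [hcomp])
  rw [hcomp, ProbabilityTheory.Kernel.const_apply] at h
  rw [h]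
  refine integral_congr_ae ?_
  filter_upwards [hG] with x hx
  rw [hκ_apply x hx]

lemma charFun_fst_eq {π : Measure (ℝ × ℝ)} (hπ : IsStationary S.P π) {t : ℝ} (ht : 0 ≤ t)
    {v : ℂ} (hv : v.re = 0) :
    ∫ y, Complex.exp (v * (y.1 : ℂ)) ∂π
      = Complex.exp (S.immigrationExponent t v)
        * ∫ x, Complex.exp ((x.1 : ℂ) * S.V₁ t (v, 0)) ∂π := by
  have := hπ.1
  have hG : ∀ᵐ x ∂π, 0 ≤ x.1 := ae_fst_nonneg_s9 hπ.2.1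
  rw [S.integral_bind_P hπ ht (Integrable.of_bound (C := 1) (by fun_prop)
    (ae_of_all _ fun y => by simp [Complex.norm_exp, hv])), ← integral_const_mul]
  refine integral_congr_ae ?_
  filter_upwards [hG] with x hx
  have h := S.P_char t ht x hx (v, 0) hv rfl
  simp only [zero_mul, mul_zero, add_zero] at h
  rw [h, add_comm, Complex.exp_add]
  rfl

lemma tendsto_integral_exp_V₁ (ha₁ : 0 < S.a₁) {π : Measure (ℝ × ℝ)} [IsProbabilityMeasure π]
    (hG : ∀ᵐ x ∂π, 0 ≤ x.1) {v : ℂ} (hv : v.re ≤ 0) :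
    Tendsto (fun t => ∫ x, Complex.exp ((x.1 : ℂ) * S.V₁ t (v, 0)) ∂π) atTop (𝓝 1) := by
  have hexp : Tendsto (fun t : ℝ => ‖v‖ * Real.exp (-S.a₁ * t)) atTop (𝓝 0) := by
    have h := Real.tendsto_exp_atBot.comp
      (tendsto_id.const_mul_atTop_of_neg (neg_neg_of_pos ha₁))
    simpa using h.const_mul ‖v‖
  have hV : Tendsto (fun t => S.V₁ t (v, 0)) atTop (𝓝 0) :=
    squeeze_zero_norm' ((eventually_ge_atTop 0).mono fun t ht => S.norm_V₁_le hv ht) hexp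
  rw [show 𝓝 (1 : ℂ) = 𝓝 (∫ _ : ℝ × ℝ, (1 : ℂ) ∂π) by simp]
  refine tendsto_integral_filter_of_dominated_convergence (fun _ => 1)
    (Eventually.of_forall fun t => by fun_prop) ?_ (integrable_const _) (ae_of_all _ fun x => ?_)
  · filter_upwards [eventually_ge_atTop 0] with t ht
    filter_upwards [hG] with x hx
    rw [Complex.norm_exp, Real.exp_le_one_iff, Complex.re_ofReal_mul]
    exact mul_nonpos_of_nonneg_of_nonpos hx (S.re_V₁_nonpos hv ht)
  · simpa using (hV.const_mul (x.1 : ℂ)).cexp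

lemma charFun_fst_sub_isLittleO (ha₁ : 0 < S.a₁) (hn : Integrable (fun z : ℝ × ℝ => z.1) S.n)
    {M : ℝ} (hM : M = S.a₁⁻¹ * (S.a₂ + ∫ z : ℝ × ℝ, z.1 ∂S.n))
    {π : Measure (ℝ × ℝ)} (hπ : IsStationary S.P π) :
    (fun θ : ℝ => (∫ y, Complex.exp ((θ * Complex.I) * (y.1 : ℂ)) ∂π)
      - Complex.exp (M * (θ * Complex.I))) =o[𝓝[>] 0] fun θ => θ := by
  have := hπ.1
  have hG : ∀ᵐ x ∂π, 0 ≤ x.1 := ae_fst_nonneg_s9 hπ.2.1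
  refine Asymptotics.isLittleO_iff.2 fun c hc => ?_
  have hε : 0 < c * S.a₁ / 2 := by positivity
  obtain ⟨δ, hδ, hball⟩ := Metric.mem_nhdsWithin_iff.1
    (Asymptotics.isLittleO_iff.1 (S.psi_add_mul_phi_isLittleO ha₁ hn hM) hε)
  have hψ (v : ℂ) (hv : v.re ≤ 0) (hvδ : ‖v‖ < δ) := hball ⟨by simpa using hvδ, hv⟩
  filter_upwards [Ioo_mem_nhdsGT (lt_min hδ (div_pos two_pos hc))] with θ hθ
  have hθδ := hθ.2.trans_le (min_le_left _ _)
  have hθc := hθ.2.trans_le (min_le_right _ _)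
  set v : ℂ := θ * Complex.I
  have hv : v.re = 0 := by simp [v]
  have hvn : ‖v‖ = θ := by simp [v, abs_of_pos hθ.1]
  have hMv : ‖Complex.exp (M * v)‖ = 1 := by simp [Complex.norm_exp, v]
  let r : ℝ → ℝ := fun T => c * θ / 2 + |M| * (θ * Real.exp (-S.a₁ * T))
  have hr : Tendsto r atTop (𝓝 (c * θ / 2)) := by
    have h := Real.tendsto_exp_atBot.comp
      (tendsto_id.const_mul_atTop_of_neg (neg_neg_of_pos ha₁))
    simpa [r] using ((h.const_mul θ).const_mul |M|).const_add (c * θ / 2)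
  have hr1 : ∀ᶠ T in atTop, r T ≤ 1 := by
    refine hr.eventually (ge_mem_nhds ?_)
    rw [lt_div_iff₀ hc] at hθc
    linarith
  have hE := S.tendsto_integral_exp_V₁ ha₁ hG hv.le
  have hlim := ((hE.const_mul (Complex.exp (M * v))).const_sub
    (∫ y, Complex.exp (v * (y.1 : ℂ)) ∂π)).norm
  rw [mul_one] at hlim
  have hrhs := (hr.const_mul 2).mul hE.norm
  rw [norm_one, mul_one] at hrhs
  have hle := le_of_tendsto_of_tendsto hlim hrhs (by
    filter_upwards [hr1, eventually_ge_atTop 0] with T hT1 hT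
    have hI : ‖S.immigrationExponent T v - M * v‖ ≤ r T := by
      refine (S.norm_immigrationExponent_sub_le ha₁ hn hε.le hψ hv.le (hvn.trans_lt hθδ)
        hT).trans_eq ?_
      simp only [r, hvn]
      field_simp
    rw [S.charFun_fst_eq hπ hT hv, ← sub_mul, norm_mul]
    refine mul_le_mul_of_nonneg_right ?_ (norm_nonneg _)
    have hfac : Complex.exp (S.immigrationExponent T v) - Complex.exp (M * v)
        = Complex.exp (M * v) * (Complex.exp (S.immigrationExponent T v - M * v) - 1) := by
      rw [mul_sub, ← Complex.exp_add]
      simp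
    rw [hfac, norm_mul, hMv, one_mul]
    linarith [Complex.norm_exp_sub_one_le (hI.trans hT1)])
  refine hle.trans_eq ?_
  rw [Real.norm_of_nonneg hθ.1.le]
  ring

lemma tendsto_integral_sin_fst_div (ha₁ : 0 < S.a₁)
    (hn : Integrable (fun z : ℝ × ℝ => z.1) S.n)
    {M : ℝ} (hM : M = S.a₁⁻¹ * (S.a₂ + ∫ z : ℝ × ℝ, z.1 ∂S.n))
    {π : Measure (ℝ × ℝ)} (hπ : IsStationary S.P π) :
    Tendsto (fun θ : ℝ => (∫ y, Real.sin (θ * y.1) ∂π) / θ) (𝓝[>] 0) (𝓝 M) := by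
  have := hπ.1
  have him : (fun θ : ℝ => (∫ y, Real.sin (θ * y.1) ∂π) - Real.sin (θ * M))
      =o[𝓝[>] 0] fun θ => θ := by
    refine (Asymptotics.isBigO_of_le _ fun θ => ?_).trans_isLittleO
      (S.charFun_fst_sub_isLittleO ha₁ hn hM hπ)
    have hint : Integrable (fun y : ℝ × ℝ => Complex.exp ((θ * Complex.I) * (y.1 : ℂ))) π :=
      Integrable.of_bound (C := 1) (by fun_prop)
        (ae_of_all _ fun y => by simp [Complex.norm_exp])
    have hsin (x : ℝ) : (Complex.exp ((θ * Complex.I) * (x : ℂ))).im = Real.sin (θ * x) := by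
      rw [show (θ * Complex.I) * (x : ℂ) = ((θ * x : ℝ) : ℂ) * Complex.I by push_cast; ring,
        Complex.exp_ofReal_mul_I_im]
    have h := integral_im hint
    simp only [RCLike.im_eq_complex_im, hsin] at h
    rw [h, ← hsin M, mul_comm (θ * Complex.I) (M : ℂ), ← Complex.sub_im]
    exact Complex.abs_im_le_norm _
  have hsin : HasDerivAt (fun θ : ℝ => Real.sin (θ * M)) M 0 := by
    simpa using ((hasDerivAt_id (0 : ℝ)).mul_const M).sin
  have hslope := (hasDerivAt_iff_tendsto_slope.1 hsin).mono_left
    (nhdsWithin_mono (0 : ℝ) (t := {0}ᶜ) (s := Set.Ioi 0) fun x hx => (Set.mem_Ioi.1 hx).ne')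
  have hsum := him.tendsto_div_nhds_zero.add hslope
  rw [zero_add] at hsum
  refine hsum.congr fun θ => ?_
  simp only [slope_def_field, zero_mul, Real.sin_zero, sub_zero]
  ring

end AffineSemigroup

/-- First moment of the stationary distribution in the first coordinate. -/
theorem stationary_first_moment
    (S : AffineSemigroup) (π : Measure (ℝ × ℝ))
    (ha₁ : 0 < S.a₁) (hb₂ : 0 < S.b₂)
    (hz₁ : ∫⁻ z in {z : ℝ × ℝ | 1 < z.1}, ENNReal.ofReal z.1 ∂S.n < ⊤)
    (hπ : IsStationary S.P π)
    (huniq : ∀ π' : Measure (ℝ × ℝ), IsStationary S.P π' → π' = π) :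
    Integrable (fun y : ℝ × ℝ => y.1) π ∧
      ∫ y : ℝ × ℝ, y.1 ∂π = S.a₁⁻¹ * (S.a₂ + ∫ z : ℝ × ℝ, z.1 ∂S.n) := by
  have hn := S.integrable_n_fst hz₁
  have := hπ.1
  have hG : ∀ᵐ x ∂π, 0 ≤ x.1 := ae_fst_nonneg_s9 hπ.2.1
  have := Measure.isProbabilityMeasure_map (μ := π) measurable_fst.aemeasurable
  have hmap : ∀ᵐ y ∂π.map Prod.fst, 0 ≤ y :=
    (ae_map_iff measurable_fst.aemeasurable measurableSet_Ici).2 hG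
  have h := first_moment_of_tendsto_sin hmap
    (M := S.a₁⁻¹ * (S.a₂ + ∫ z : ℝ × ℝ, z.1 ∂S.n)) (by
      refine (S.tendsto_integral_sin_fst_div ha₁ hn rfl hπ).congr fun θ => ?_
      rw [integral_map measurable_fst.aemeasurable (by fun_prop)])
  rw [integrable_map_measure (by fun_prop) measurable_fst.aemeasurable,
    integral_map measurable_fst.aemeasurable (by fun_prop)] at h
  exact h

end AffinePaper
end
end
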